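/- (⊢ to ⊢# Theorem) If Γ is an inert typing context, then general typing implies tight typing and general subtyping implies tight subtyping: if Γ ⊢ t : T then Γ ⊢# t : T, and if Γ ⊢ S <: U then Γ ⊢# S <: U. -/

import Mathlib

/- Variables and labels -/
abbrev Vr := ℕ
abbrev TrmLabel := ℕ
abbrev TypLabel := ℕ

/- Types of the DOT calculus -/
inductive Typ : Type
| top : Typ                          -- ⊤
| bot : Typ                          -- ⊥
| all : Vr → Typ → Typ → Typ         -- ∀(x:S)T
| mu  : Vr → Typ → Typ               -- μ(x:T)
| fld : TrmLabel → Typ → Typ         -- {a : T}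
| dec : TypLabel → Typ → Typ → Typ   -- {A : S..T}
| sel : Vr → TypLabel → Typ          -- x.A
| and : Typ → Typ → Typ              -- S ∧ T
deriving DecidableEq

/- Terms, values, definitions -/
mutual
inductive Trm : Type
| var : Vr → Trm
| val : Vl → Trm
| sel : Vr → TrmLabel → Trm
| app : Vr → Vr → Trm
| lett : Vr → Trm → Trm → Trm
deriving DecidableEq
inductive Vl : Type
| lam : Vr → Typ → Trm → Vl          -- λ(x:T)t
| obj : Vr → Typ → Dfs → Vl          -- ν(x:T)d
deriving DecidableEq
inductive Dfs : Type
| fld : TrmLabel → Trm → Dfs         -- {a = t}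
| typ : TypLabel → Typ → Dfs         -- {A = T}
| and : Dfs → Dfs → Dfs
deriving DecidableEq
end

/- Free variables -/
def Typ.fv : Typ → Finset Vr
| .top => ∅
| .bot => ∅
| .all x S T => S.fv ∪ (T.fv \ {x})
| .mu x T => T.fv \ {x}
| .fld _ T => T.fv
| .dec _ S T => S.fv ∪ T.fv
| .sel x _ => {x}
| .and S T => S.fv ∪ T.fv

mutual
def Trm.fv : Trm → Finset Vr
| .var x => {x}
| .val v => v.fv
| .sel x _ => {x}
| .app x y => {x, y}
| .lett x t u => t.fv ∪ (u.fv \ {x})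
def Vl.fv : Vl → Finset Vr
| .lam x T t => T.fv ∪ (t.fv \ {x})
| .obj x T d => (T.fv ∪ d.fv) \ {x}
def Dfs.fv : Dfs → Finset Vr
| .fld _ t => t.fv
| .typ _ T => T.fv
| .and d₁ d₂ => d₁.fv ∪ d₂.fv
end

/- Substitution of variable y for variable x (capture-avoiding; only
   variable-for-variable substitution is needed in DOT) -/
def Typ.subst (x y : Vr) : Typ → Typ
| .top => .top
| .bot => .bot
| .all z S T => .all z (S.subst x y) (if z = x then T else T.subst x y)
| .mu z T => .mu z (if z = x then T else T.subst x y)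
| .fld a T => .fld a (T.subst x y)
| .dec A S T => .dec A (S.subst x y) (T.subst x y)
| .sel z A => .sel (if z = x then y else z) A
| .and S T => .and (S.subst x y) (T.subst x y)

mutual
def Trm.subst (x y : Vr) : Trm → Trm
| .var z => .var (if z = x then y else z)
| .val v => .val (v.subst x y)
| .sel z a => .sel (if z = x then y else z) a
| .app z w => .app (if z = x then y else z) (if w = x then y else w)
| .lett z t u => .lett z (t.subst x y) (if z = x then u else u.subst x y)
def Vl.subst (x y : Vr) : Vl → Vl
| .lam z T t => .lam z (T.subst x y) (if z = x then t else t.subst x y)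
| .obj z T d => .obj z (if z = x then T else T.subst x y) (if z = x then d else d.subst x y)
def Dfs.subst (x y : Vr) : Dfs → Dfs
| .fld a t => .fld a (t.subst x y)
| .typ A T => .typ A (T.subst x y)
| .and d₁ d₂ => .and (d₁.subst x y) (d₂.subst x y)
end

/- Typing contexts -/
abbrev Ctx := List (Vr × Typ)

def lookupCtx : Ctx → Vr → Option Typ
| [], _ => none
| (y, T) :: Γ, x => if x = y then some T else lookupCtx Γ x

/- Domain (labels) of a collection of definitions -/
def Dfs.dom : Dfs → Finset (TrmLabel ⊕ TypLabel)
| .fld a _ => {Sum.inl a}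
| .typ A _ => {Sum.inr A}
| .and d₁ d₂ => d₁.dom ∪ d₂.dom

/- Record types: intersections of field declarations and tight type
   declarations with pairwise distinct type labels (the Finset collects
   the type labels) -/
inductive RecordTyp : Typ → Finset TypLabel → Prop
| fld : ∀ (a : TrmLabel) (T : Typ), RecordTyp (.fld a T) ∅
| dec : ∀ (A : TypLabel) (T : Typ), RecordTyp (.dec A T T) {A}
| and : ∀ {T U : Typ} {L₁ L₂ : Finset TypLabel},
    RecordTyp T L₁ → RecordTyp U L₂ → Disjoint L₁ L₂ → RecordTyp (.and T U) (L₁ ∪ L₂)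

/- Inert types and inert contexts -/
inductive Inert : Typ → Prop
| all : ∀ (x : Vr) (S T : Typ), Inert (.all x S T)
| mu : ∀ {x : Vr} {T : Typ} {L : Finset TypLabel}, RecordTyp T L → Inert (.mu x T)

def InertCtx (Γ : Ctx) : Prop := ∀ x T, lookupCtx Γ x = some T → Inert T

/- General typing, definition typing and subtyping -/
mutual
inductive HasTyp : Ctx → Trm → Typ → Prop
| var : ∀ {Γ : Ctx} {x : Vr} {T : Typ},
    lookupCtx Γ x = some T → HasTyp Γ (.var x) T
| allI : ∀ {Γ : Ctx} {x : Vr} {T U : Typ} {t : Trm},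
    HasTyp ((x, T) :: Γ) t U → x ∉ T.fv →
    HasTyp Γ (.val (.lam x T t)) (.all x T U)
| allE : ∀ {Γ : Ctx} {x y z : Vr} {S T : Typ},
    HasTyp Γ (.var x) (.all z S T) → HasTyp Γ (.var y) S →
    HasTyp Γ (.app x y) (T.subst z y)
| objI : ∀ {Γ : Ctx} {x : Vr} {T : Typ} {d : Dfs},
    DefTyp ((x, T) :: Γ) d T → HasTyp Γ (.val (.obj x T d)) (.mu x T)
| fldE : ∀ {Γ : Ctx} {x : Vr} {a : TrmLabel} {T : Typ},
    HasTyp Γ (.var x) (.fld a T) → HasTyp Γ (.sel x a) T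
| lett : ∀ {Γ : Ctx} {x : Vr} {t u : Trm} {T U : Typ},
    HasTyp Γ t T → HasTyp ((x, T) :: Γ) u U → x ∉ U.fv →
    HasTyp Γ (.lett x t u) U
| recI : ∀ {Γ : Ctx} {x : Vr} {T : Typ},
    HasTyp Γ (.var x) T → HasTyp Γ (.var x) (.mu x T)
| recE : ∀ {Γ : Ctx} {x z : Vr} {T : Typ},
    HasTyp Γ (.var x) (.mu z T) → HasTyp Γ (.var x) (T.subst z x)
| andI : ∀ {Γ : Ctx} {x : Vr} {T U : Typ},
    HasTyp Γ (.var x) T → HasTyp Γ (.var x) U → HasTyp Γ (.var x) (.and T U)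
| sub : ∀ {Γ : Ctx} {t : Trm} {T U : Typ},
    HasTyp Γ t T → Subtyp Γ T U → HasTyp Γ t U

inductive DefTyp : Ctx → Dfs → Typ → Prop
| fld : ∀ {Γ : Ctx} {a : TrmLabel} {t : Trm} {U : Typ},
    HasTyp Γ t U → DefTyp Γ (.fld a t) (.fld a U)
| typ : ∀ {Γ : Ctx} (A : TypLabel) (T : Typ), DefTyp Γ (.typ A T) (.dec A T T)
| and : ∀ {Γ : Ctx} {d₁ d₂ : Dfs} {T₁ T₂ : Typ},
    DefTyp Γ d₁ T₁ → DefTyp Γ d₂ T₂ → Disjoint d₁.dom d₂.dom →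
    DefTyp Γ (.and d₁ d₂) (.and T₁ T₂)

inductive Subtyp : Ctx → Typ → Typ → Prop
| top : ∀ {Γ : Ctx} {T : Typ}, Subtyp Γ T .top
| bot : ∀ {Γ : Ctx} {T : Typ}, Subtyp Γ .bot T
| refl : ∀ {Γ : Ctx} {T : Typ}, Subtyp Γ T T
| trans : ∀ {Γ : Ctx} {S T U : Typ},
    Subtyp Γ S T → Subtyp Γ T U → Subtyp Γ S U
| and1 : ∀ {Γ : Ctx} {T U : Typ}, Subtyp Γ (.and T U) T
| and2 : ∀ {Γ : Ctx} {T U : Typ}, Subtyp Γ (.and T U) U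
| andI : ∀ {Γ : Ctx} {S T U : Typ},
    Subtyp Γ S T → Subtyp Γ S U → Subtyp Γ S (.and T U)
| fld : ∀ {Γ : Ctx} {a : TrmLabel} {T U : Typ},
    Subtyp Γ T U → Subtyp Γ (.fld a T) (.fld a U)
| typ : ∀ {Γ : Ctx} {A : TypLabel} {S₁ S₂ T₁ T₂ : Typ},
    Subtyp Γ S₂ S₁ → Subtyp Γ T₁ T₂ →
    Subtyp Γ (.dec A S₁ T₁) (.dec A S₂ T₂)
| selLo : ∀ {Γ : Ctx} {x : Vr} {A : TypLabel} {S T : Typ},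
    HasTyp Γ (.var x) (.dec A S T) → Subtyp Γ S (.sel x A)
| selHi : ∀ {Γ : Ctx} {x : Vr} {A : TypLabel} {S T : Typ},
    HasTyp Γ (.var x) (.dec A S T) → Subtyp Γ (.sel x A) T
| all : ∀ {Γ : Ctx} {x : Vr} {S₁ S₂ T₁ T₂ : Typ},
    Subtyp Γ S₂ S₁ → Subtyp ((x, S₂) :: Γ) T₁ T₂ →
    Subtyp Γ (.all x S₁ T₁) (.all x S₂ T₂)
end

/- Precise typing  Γ ⊢! t : T -/
inductive PrecTyp : Ctx → Trm → Typ → Prop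
| var : ∀ {Γ : Ctx} {x : Vr} {T : Typ},
    lookupCtx Γ x = some T → PrecTyp Γ (.var x) T
| recE : ∀ {Γ : Ctx} {x z : Vr} {T : Typ},
    PrecTyp Γ (.var x) (.mu z T) → PrecTyp Γ (.var x) (T.subst z x)
| and1 : ∀ {Γ : Ctx} {x : Vr} {T U : Typ},
    PrecTyp Γ (.var x) (.and T U) → PrecTyp Γ (.var x) T
| and2 : ∀ {Γ : Ctx} {x : Vr} {T U : Typ},
    PrecTyp Γ (.var x) (.and T U) → PrecTyp Γ (.var x) U
| allI : ∀ {Γ : Ctx} {x : Vr} {T U : Typ} {t : Trm},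
    HasTyp ((x, T) :: Γ) t U → x ∉ T.fv →
    PrecTyp Γ (.val (.lam x T t)) (.all x T U)
| objI : ∀ {Γ : Ctx} {x : Vr} {T : Typ} {d : Dfs},
    DefTyp ((x, T) :: Γ) d T → PrecTyp Γ (.val (.obj x T d)) (.mu x T)

/- Tight typing  Γ ⊢# t : T  and tight subtyping  Γ ⊢# S <: U -/
mutual
inductive TightTyp : Ctx → Trm → Typ → Prop
| var : ∀ {Γ : Ctx} {x : Vr} {T : Typ},
    lookupCtx Γ x = some T → TightTyp Γ (.var x) T
| allI : ∀ {Γ : Ctx} {x : Vr} {T U : Typ} {t : Trm},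
    HasTyp ((x, T) :: Γ) t U → x ∉ T.fv →
    TightTyp Γ (.val (.lam x T t)) (.all x T U)
| allE : ∀ {Γ : Ctx} {x y z : Vr} {S T : Typ},
    TightTyp Γ (.var x) (.all z S T) → TightTyp Γ (.var y) S →
    TightTyp Γ (.app x y) (T.subst z y)
| objI : ∀ {Γ : Ctx} {x : Vr} {T : Typ} {d : Dfs},
    DefTyp ((x, T) :: Γ) d T → TightTyp Γ (.val (.obj x T d)) (.mu x T)
| fldE : ∀ {Γ : Ctx} {x : Vr} {a : TrmLabel} {T : Typ},
    TightTyp Γ (.var x) (.fld a T) → TightTyp Γ (.sel x a) T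
| lett : ∀ {Γ : Ctx} {x : Vr} {t u : Trm} {T U : Typ},
    TightTyp Γ t T → HasTyp ((x, T) :: Γ) u U → x ∉ U.fv →
    TightTyp Γ (.lett x t u) U
| recI : ∀ {Γ : Ctx} {x : Vr} {T : Typ},
    TightTyp Γ (.var x) T → TightTyp Γ (.var x) (.mu x T)
| recE : ∀ {Γ : Ctx} {x z : Vr} {T : Typ},
    TightTyp Γ (.var x) (.mu z T) → TightTyp Γ (.var x) (T.subst z x)
| andI : ∀ {Γ : Ctx} {x : Vr} {T U : Typ},
    TightTyp Γ (.var x) T → TightTyp Γ (.var x) U → TightTyp Γ (.var x) (.and T U)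
| sub : ∀ {Γ : Ctx} {t : Trm} {T U : Typ},
    TightTyp Γ t T → TightSub Γ T U → TightTyp Γ t U

inductive TightSub : Ctx → Typ → Typ → Prop
| top : ∀ {Γ : Ctx} {T : Typ}, TightSub Γ T .top
| bot : ∀ {Γ : Ctx} {T : Typ}, TightSub Γ .bot T
| refl : ∀ {Γ : Ctx} {T : Typ}, TightSub Γ T T
| trans : ∀ {Γ : Ctx} {S T U : Typ},
    TightSub Γ S T → TightSub Γ T U → TightSub Γ S U
| and1 : ∀ {Γ : Ctx} {T U : Typ}, TightSub Γ (.and T U) T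
| and2 : ∀ {Γ : Ctx} {T U : Typ}, TightSub Γ (.and T U) U
| andI : ∀ {Γ : Ctx} {S T U : Typ},
    TightSub Γ S T → TightSub Γ S U → TightSub Γ S (.and T U)
| fld : ∀ {Γ : Ctx} {a : TrmLabel} {T U : Typ},
    TightSub Γ T U → TightSub Γ (.fld a T) (.fld a U)
| typ : ∀ {Γ : Ctx} {A : TypLabel} {S₁ S₂ T₁ T₂ : Typ},
    TightSub Γ S₂ S₁ → TightSub Γ T₁ T₂ →
    TightSub Γ (.dec A S₁ T₁) (.dec A S₂ T₂)
| selLo : ∀ {Γ : Ctx} {x : Vr} {A : TypLabel} {T : Typ},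
    PrecTyp Γ (.var x) (.dec A T T) → TightSub Γ T (.sel x A)
| selHi : ∀ {Γ : Ctx} {x : Vr} {A : TypLabel} {T : Typ},
    PrecTyp Γ (.var x) (.dec A T T) → TightSub Γ (.sel x A) T
| all : ∀ {Γ : Ctx} {x : Vr} {S₁ S₂ T₁ T₂ : Typ},
    TightSub Γ S₂ S₁ → Subtyp ((x, S₂) :: Γ) T₁ T₂ →
    TightSub Γ (.all x S₁ T₁) (.all x S₂ T₂)
end

/- Invertible typing  Γ ⊢## t : T  for variables and values -/
inductive InvTyp : Ctx → Trm → Typ → Prop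
| var : ∀ {Γ : Ctx} {x : Vr} {T : Typ},
    PrecTyp Γ (.var x) T → InvTyp Γ (.var x) T
| fld : ∀ {Γ : Ctx} {x : Vr} {a : TrmLabel} {T U : Typ},
    InvTyp Γ (.var x) (.fld a T) → TightSub Γ T U →
    InvTyp Γ (.var x) (.fld a U)
| typ : ∀ {Γ : Ctx} {x : Vr} {A : TypLabel} {T T' U U' : Typ},
    InvTyp Γ (.var x) (.dec A T U) → TightSub Γ T' T → TightSub Γ U U' →
    InvTyp Γ (.var x) (.dec A T' U')
| recI : ∀ {Γ : Ctx} {x : Vr} {T : Typ},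
    InvTyp Γ (.var x) T → InvTyp Γ (.var x) (.mu x T)
| allI : ∀ {Γ : Ctx} {x z : Vr} {S S' T T' : Typ},
    InvTyp Γ (.var x) (.all z S T) → TightSub Γ S' S →
    Subtyp ((z, S') :: Γ) T T' →
    InvTyp Γ (.var x) (.all z S' T')
| andI : ∀ {Γ : Ctx} {x : Vr} {T U : Typ},
    InvTyp Γ (.var x) T → InvTyp Γ (.var x) U → InvTyp Γ (.var x) (.and T U)
| sel : ∀ {Γ : Ctx} {x y : Vr} {A : TypLabel} {S : Typ},
    InvTyp Γ (.var x) S → PrecTyp Γ (.var y) (.dec A S S) →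
    InvTyp Γ (.var x) (.sel y A)
| top : ∀ {Γ : Ctx} {x : Vr} {T : Typ},
    InvTyp Γ (.var x) T → InvTyp Γ (.var x) .top
| val : ∀ {Γ : Ctx} {v : Vl} {T : Typ},
    PrecTyp Γ (.val v) T → InvTyp Γ (.val v) T
| allV : ∀ {Γ : Ctx} {v : Vl} {z : Vr} {S S' T T' : Typ},
    InvTyp Γ (.val v) (.all z S T) → TightSub Γ S' S →
    Subtyp ((z, S') :: Γ) T T' →
    InvTyp Γ (.val v) (.all z S' T')
| andV : ∀ {Γ : Ctx} {v : Vl} {T U : Typ},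
    InvTyp Γ (.val v) T → InvTyp Γ (.val v) U → InvTyp Γ (.val v) (.and T U)
| selV : ∀ {Γ : Ctx} {v : Vl} {y : Vr} {A : TypLabel} {S : Typ},
    InvTyp Γ (.val v) S → PrecTyp Γ (.var y) (.dec A S S) →
    InvTyp Γ (.val v) (.sel y A)
| topV : ∀ {Γ : Ctx} {v : Vl} {T : Typ},
    InvTyp Γ (.val v) T → InvTyp Γ (.val v) .top

/- A definition collection contains the field definition {a = t} -/
inductive DefHasFld : Dfs → TrmLabel → Trm → Prop
| fld : ∀ (a : TrmLabel) (t : Trm), DefHasFld (.fld a t) a t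
| andL : ∀ {d₁ : Dfs} {a : TrmLabel} {t : Trm} (d₂ : Dfs),
    DefHasFld d₁ a t → DefHasFld (.and d₁ d₂) a t
| andR : ∀ {d₂ : Dfs} {a : TrmLabel} {t : Trm} (d₁ : Dfs),
    DefHasFld d₂ a t → DefHasFld (.and d₁ d₂) a t

/- A type (an intersection) contains the field declaration {a : T} -/
inductive TypHasFld : Typ → TrmLabel → Typ → Prop
| fld : ∀ (a : TrmLabel) (T : Typ), TypHasFld (.fld a T) a T
| andL : ∀ {S : Typ} {a : TrmLabel} {T : Typ} (S' : Typ),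
    TypHasFld S a T → TypHasFld (.and S S') a T
| andR : ∀ {S' : Typ} {a : TrmLabel} {T : Typ} (S : Typ),
    TypHasFld S' a T → TypHasFld (.and S S') a T

/- Evaluation contexts  e ::= [] | let x = [] in t | let x = v in e -/
inductive ECtx : Type
| hole : ECtx
| letHole : Vr → Trm → ECtx
| letVal : Vr → Vl → ECtx → ECtx

def ECtx.plug : ECtx → Trm → Trm
| .hole, t => t
| .letHole x u, t => .lett x t u
| .letVal x v e, t => .lett x (.val v) (e.plug t)

/- Small-step operational semantics -/
inductive Red : Trm → Trm → Prop
| apply : ∀ (x y z : Vr) (T : Typ) (t : Trm) (e : ECtx),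
    Red (.lett x (.val (.lam z T t)) (ECtx.plug e (.app x y)))
        (.lett x (.val (.lam z T t)) (ECtx.plug e (t.subst z y)))
| project : ∀ (x : Vr) (T : Typ) (d : Dfs) (a : TrmLabel) (t : Trm) (e : ECtx),
    DefHasFld d a t →
    Red (.lett x (.val (.obj x T d)) (ECtx.plug e (.sel x a)))
        (.lett x (.val (.obj x T d)) (ECtx.plug e t))
| letVar : ∀ (x y : Vr) (t : Trm),
    Red (.lett x (.var y) t) (t.subst x y)
| letLet : ∀ (x y : Vr) (s t u : Trm),
    Red (.lett x (.lett y s t) u) (.lett y s (.lett x t u))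
| ctx : ∀ {t t' : Trm} (e : ECtx),
    Red t t' → Red (ECtx.plug e t) (ECtx.plug e t')

/- Normal forms: variables and values -/
def NormalForm : Trm → Prop
| .var _ => True
| .val _ => True
| _ => False

/- Replacing the binding of x in a context -/
def updateCtx : Ctx → Vr → Typ → Ctx
| [], _, _ => []
| (y, S) :: Γ, x, T => if y = x then (x, T) :: Γ else (y, S) :: updateCtx Γ x T

inductive Mem : Typ → Typ → Prop
| self : ∀ T, Mem T T
| l : ∀ {T S U}, Mem T S → Mem T (.and S U)
| r : ∀ {T S U}, Mem T U → Mem T (.and S U)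

theorem Mem.tr {a b c : Typ} (h1 : Mem a b) (h2 : Mem b c) : Mem a c := by
  induction h2 with
  | self => exact h1
  | l _ ih => exact .l ih
  | r _ ih => exact .r ih

theorem RecordTyp.subst' {T : Typ} {L} (h : RecordTyp T L) (x y : Vr) :
    RecordTyp (T.subst x y) L := by
  induction h with
  | fld a T => exact .fld _ _
  | dec A T => exact .dec _ _
  | and _ _ hd ih1 ih2 => exact .and ih1 ih2 hd

theorem RecordTyp.mem {T : Typ} {L} (h : RecordTyp T L) {S : Typ} (hm : Mem S T) :
    ∃ L', L' ⊆ L ∧ RecordTyp S L' := by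
  induction hm generalizing L with
  | self => exact ⟨L, subset_rfl, h⟩
  | l _ ih =>
    cases h with
    | and h1 h2 hd =>
      obtain ⟨L', hs, hr⟩ := ih h1
      exact ⟨L', hs.trans Finset.subset_union_left, hr⟩
  | r _ ih =>
    cases h with
    | and h1 h2 hd =>
      obtain ⟨L', hs, hr⟩ := ih h2
      exact ⟨L', hs.trans Finset.subset_union_right, hr⟩

theorem RecordTyp.memDec {T : Typ} {L} (h : RecordTyp T L) {A S U}
    (hm : Mem (.dec A S U) T) : A ∈ L ∧ S = U := by
  obtain ⟨L', hs, hr⟩ := h.mem hm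
  cases hr with
  | dec => exact ⟨hs (by simp), rfl⟩

theorem RecordTyp.uniq {T : Typ} {L} (h : RecordTyp T L) {A S U}
    (h1 : Mem (.dec A S S) T) (h2 : Mem (.dec A U U) T) : S = U := by
  induction h with
  | fld a T => cases h1
  | dec B T => cases h1; cases h2; rfl
  | and ha hb hd ih1 ih2 =>
    cases h1 with
    | l h1 =>
      cases h2 with
      | l h2 => exact ih1 h1 h2
      | r h2 => exact absurd (hb.memDec h2).1 (Finset.disjoint_left.1 hd (ha.memDec h1).1)
    | r h1 =>
      cases h2 with
      | r h2 => exact ih2 h1 h2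
      | l h2 => exact absurd (hb.memDec h1).1 (Finset.disjoint_left.1 hd (ha.memDec h2).1)

theorem prec_inv {Γ : Ctx} (hΓ : InertCtx Γ) {t : Trm} {T : Typ} (h : PrecTyp Γ t T) :
    ∀ x, t = .var x →
    (lookupCtx Γ x = some T ∧ Inert T) ∨
    ∃ z R L, lookupCtx Γ x = some (.mu z R) ∧ RecordTyp R L ∧ Mem T (R.subst z x) := by
  induction h with
  | var h => rintro x ⟨⟩; exact .inl ⟨h, hΓ _ _ h⟩
  | recE _ ih =>
    rintro x ⟨⟩
    rcases ih _ rfl with ⟨h, hi⟩ | ⟨z, R, L, h, hr, hm⟩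
    · cases hi with
      | mu hr => exact .inr ⟨_, _, _, h, hr, .self _⟩
    · obtain ⟨L', _, hh⟩ := (hr.subst' _ _).mem hm
      cases hh
  | and1 _ ih =>
    rintro x ⟨⟩
    rcases ih _ rfl with ⟨h, hi⟩ | ⟨z, R, L, h, hr, hm⟩
    · cases hi
    · exact .inr ⟨z, R, L, h, hr, .tr (.l (.self _)) hm⟩
  | and2 _ ih =>
    rintro x ⟨⟩
    rcases ih _ rfl with ⟨h, hi⟩ | ⟨z, R, L, h, hr, hm⟩
    · cases hi
    · exact .inr ⟨z, R, L, h, hr, .tr (.r (.self _)) hm⟩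
  | allI => rintro x ⟨⟩
  | objI => rintro x ⟨⟩

theorem prec_dec {Γ : Ctx} (hΓ : InertCtx Γ) {x A S U}
    (h : PrecTyp Γ (.var x) (.dec A S U)) : S = U := by
  rcases prec_inv hΓ h _ rfl with ⟨h, hi⟩ | ⟨z, R, L, h, hr, hm⟩
  · cases hi
  · exact ((hr.subst' _ _).memDec hm).2

theorem prec_uniq {Γ : Ctx} (hΓ : InertCtx Γ) {x A S U}
    (h : PrecTyp Γ (.var x) (.dec A S S)) (h' : PrecTyp Γ (.var x) (.dec A U U)) : S = U := by
  rcases prec_inv hΓ h _ rfl with ⟨h, hi⟩ | ⟨z, R, L, h, hr, hm⟩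
  · cases hi
  rcases prec_inv hΓ h' _ rfl with ⟨h', hi⟩ | ⟨z', R', L', h', hr', hm'⟩
  · cases hi
  rw [h] at h'
  cases h'
  exact (hr.subst' _ _).uniq hm hm'

theorem prec_bot {Γ : Ctx} (hΓ : InertCtx Γ) {x}
    (h : PrecTyp Γ (.var x) .bot) : False := by
  rcases prec_inv hΓ h _ rfl with ⟨h, hi⟩ | ⟨z, R, L, h, hr, hm⟩
  · cases hi
  · obtain ⟨L', _, hh⟩ := (hr.subst' _ _).mem hm
    cases hh

theorem prec_sel {Γ : Ctx} (hΓ : InertCtx Γ) {x y A}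
    (h : PrecTyp Γ (.var x) (.sel y A)) : False := by
  rcases prec_inv hΓ h _ rfl with ⟨h, hi⟩ | ⟨z, R, L, h, hr, hm⟩
  · cases hi
  · obtain ⟨L', _, hh⟩ := (hr.subst' _ _).mem hm
    cases hh

theorem inv_dec {Γ : Ctx} (hΓ : InertCtx Γ) {t : Trm} {V : Typ} (h : InvTyp Γ t V) :
    ∀ x A S U, t = .var x → V = .dec A S U →
    ∃ T, PrecTyp Γ (.var x) (.dec A T T) ∧ TightSub Γ S T ∧ TightSub Γ T U := by
  induction h with
  | var h =>
    rintro x A S U ⟨⟩ rfl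
    obtain rfl := prec_dec hΓ h
    exact ⟨_, h, .refl, .refl⟩
  | typ _ h1 h2 ih =>
    rintro x A S U ⟨⟩ ⟨⟩
    obtain ⟨T, hp, ha, hb⟩ := ih _ _ _ _ rfl rfl
    exact ⟨T, hp, h1.trans ha, hb.trans h2⟩
  | _ => rintro x A S U h1 h2; first | cases h1; done | cases h2; done

theorem inv_sub {Γ : Ctx} {S U : Typ} (h : TightSub Γ S U) :
    InertCtx Γ → ∀ x, InvTyp Γ (.var x) S → InvTyp Γ (.var x) U := by
  refine TightSub.rec (motive_1 := fun _ _ _ => True)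
    (motive_2 := fun S U _ => InertCtx Γ → ∀ x, InvTyp Γ (.var x) S → InvTyp Γ (.var x) U)
    ?_ ?_ ?_ ?_ ?_ ?_ ?_ ?_ ?_ ?_ ?_ ?_ ?_ ?_ ?_ ?_ ?_ ?_ ?_ ?_ ?_ ?_ h
  iterate 10 (intros; trivial)
  · intro T hΓ x h; exact .top h
  · intro T hΓ x h
    cases h with
    | var h => exact (prec_bot hΓ h).elim
  · intro T hΓ x h; exact h
  · intro S T U _ _ ih1 ih2 hΓ x h; exact ih2 hΓ x (ih1 hΓ x h)
  · intro T U hΓ x h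
    cases h with
    | var h => exact .var (.and1 h)
    | andI h _ => exact h
  · intro T U hΓ x h
    cases h with
    | var h => exact .var (.and2 h)
    | andI _ h => exact h
  · intro S T U _ _ ih1 ih2 hΓ x h; exact .andI (ih1 hΓ x h) (ih2 hΓ x h)
  · intro a T U hs _ hΓ x h; exact .fld h hs
  · intro A S1 S2 T1 T2 h1 h2 _ _ hΓ x h; exact .typ h h1 h2
  · intro y A T hp hΓ x h; exact .sel h hp
  · intro y A T hp hΓ x h
    cases h with
    | var h => exact (prec_sel hΓ h).elim
    | sel h hp' => obtain rfl := prec_uniq hΓ hp hp'; exact h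
  · intro z S1 S2 T1 T2 h1 h2 _ hΓ x h; exact .allI h h1 h2

theorem Typ.subst_self (x : Vr) (T : Typ) : T.subst x x = T := by
  induction T with
  | sel z A => simp only [Typ.subst]; split <;> simp_all
  | _ => simp_all [Typ.subst]

theorem tight_inv {Γ : Ctx} {t : Trm} {T : Typ} (h : TightTyp Γ t T) :
    InertCtx Γ → ∀ x, t = .var x → InvTyp Γ (.var x) T := by
  refine TightTyp.rec
    (motive_1 := fun t T _ => InertCtx Γ → ∀ x, t = .var x → InvTyp Γ (.var x) T)
    (motive_2 := fun _ _ _ => True)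
    ?_ ?_ ?_ ?_ ?_ ?_ ?_ ?_ ?_ ?_ ?_ ?_ ?_ ?_ ?_ ?_ ?_ ?_ ?_ ?_ ?_ ?_ h
  · rintro x T h hΓ _ ⟨⟩; exact .var (.var h)
  · rintro x T U t _ _ hΓ _ ⟨⟩
  · rintro x y z S T _ _ _ _ hΓ _ ⟨⟩
  · rintro x T d _ hΓ _ ⟨⟩
  · rintro x a T _ _ hΓ _ ⟨⟩
  · rintro x t u T U _ _ _ _ hΓ _ ⟨⟩
  · rintro x T _ ih hΓ _ ⟨⟩; exact .recI (ih hΓ _ rfl)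
  · rintro x z T _ ih hΓ _ ⟨⟩
    have h := ih hΓ _ rfl
    cases h with
    | var h => exact .var (.recE h)
    | recI h => rw [Typ.subst_self]; exact h
  · rintro x T U _ _ ih1 ih2 hΓ _ ⟨⟩; exact .andI (ih1 hΓ _ rfl) (ih2 hΓ _ rfl)
  · rintro t T U _ hs ih _ hΓ x rfl; exact inv_sub hs hΓ x (ih hΓ _ rfl)
  all_goals intros; trivial

theorem tight_dec {Γ : Ctx} (hΓ : InertCtx Γ) {x A S U} (h : TightTyp Γ (.var x) (.dec A S U)) :
    ∃ T, PrecTyp Γ (.var x) (.dec A T T) ∧ TightSub Γ S T ∧ TightSub Γ T U :=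
  inv_dec hΓ (tight_inv h hΓ x rfl) _ _ _ _ rfl rfl

mutual
theorem gen_typ {Γ : Ctx} {t : Trm} {T : Typ} : HasTyp Γ t T → InertCtx Γ → TightTyp Γ t T
  | .var h, hΓ => .var h
  | .allI h h', hΓ => .allI h h'
  | .allE h h', hΓ => .allE (gen_typ h hΓ) (gen_typ h' hΓ)
  | .objI h, hΓ => .objI h
  | .fldE h, hΓ => .fldE (gen_typ h hΓ)
  | .lett h h' h'', hΓ => .lett (gen_typ h hΓ) h' h''
  | .recI h, hΓ => .recI (gen_typ h hΓ)
  | .recE h, hΓ => .recE (gen_typ h hΓ)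
  | .andI h h', hΓ => .andI (gen_typ h hΓ) (gen_typ h' hΓ)
  | .sub h h', hΓ => .sub (gen_typ h hΓ) (gen_sub h' hΓ)
theorem gen_sub {Γ : Ctx} {S U : Typ} : Subtyp Γ S U → InertCtx Γ → TightSub Γ S U
  | .top, hΓ => .top
  | .bot, hΓ => .bot
  | .refl, hΓ => .refl
  | .trans h h', hΓ => .trans (gen_sub h hΓ) (gen_sub h' hΓ)
  | .and1, hΓ => .and1
  | .and2, hΓ => .and2
  | .andI h h', hΓ => .andI (gen_sub h hΓ) (gen_sub h' hΓ)
  | .fld h, hΓ => .fld (gen_sub h hΓ)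
  | .typ h h', hΓ => .typ (gen_sub h hΓ) (gen_sub h' hΓ)
  | .selLo h, hΓ =>
    let ⟨T, hp, h1, h2⟩ := tight_dec hΓ (gen_typ h hΓ)
    h1.trans (.selLo hp)
  | .selHi h, hΓ =>
    let ⟨T, hp, h1, h2⟩ := tight_dec hΓ (gen_typ h hΓ)
    .trans (.selHi hp) h2
  | .all h h', hΓ => .all (gen_sub h hΓ) h'
end

/- STATEMENT 0: (⊢ to ⊢#) If Γ is inert, general typing implies tight typing
   and general subtyping implies tight subtyping. -/
theorem general_to_tight (Γ : Ctx) (hΓ : InertCtx Γ) :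
    (∀ (t : Trm) (T : Typ), HasTyp Γ t T → TightTyp Γ t T) ∧
    (∀ (S U : Typ), Subtyp Γ S U → TightSub Γ S U) := by
  exact ⟨fun _ _ h => gen_typ h hΓ, fun _ _ h => gen_sub h hΓ⟩
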